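/- Infinitesimal diffeomorphisms of asymptotically Poincaré type preserve asymptotic flatness: let η = diag(−1,1,1,1), let g : ℝ⁴ → ℝ^{4×4} be continuously differentiable with symmetric values, and suppose there is C ≥ 0 such that ‖g(x) − η‖ ≤ C/‖x‖ and ‖∂_σ g(x)‖ ≤ C/‖x‖² for all ‖x‖ ≥ 1 and all σ. Let ω be a 4×4 real matrix with ηω + ωᵀη = 0, let a ∈ ℝ⁴, and let ε : ℝ⁴ → ℝ⁴ be continuously differentiable with ‖ε(x) − ωx − a‖ ≤ C/‖x‖ and ‖∂_ν ε^μ(x) − ω^μ_ν‖ ≤ C/‖x‖² for all ‖x‖ ≥ 1. Then there exists C′ ≥ 0 such that the Lie-derivative variation δ_D g_{μν} := ε^ρ ∂_ρ g_{μν} + g_{μρ} ∂_ν ε^ρ + g_{ρν} ∂_μ ε^ρ satisfies ‖δ_D g(x)‖ ≤ C′/‖x‖ for all ‖x‖ ≥ 1. -/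

import Mathlib

noncomputable section

/-- Partial derivative in the `μ`-th coordinate direction of `f : ℝ⁴ → ℝ`
(`ℝ⁴` carrying the Euclidean norm). -/
def pd (μ : Fin 4) (f : EuclideanSpace ℝ (Fin 4) → ℝ) (x : EuclideanSpace ℝ (Fin 4)) : ℝ :=
  fderiv ℝ f x (EuclideanSpace.single μ 1)

/-- The Minkowski metric `η = diag(−1,1,1,1)`. -/
def minkowski : Fin 4 → Fin 4 → ℝ := fun μ ν =>
  if μ = ν then (if μ = 0 then -1 else 1) else 0

/-- The Lie-derivative variation
`δ_D g_{μν} = ε^ρ ∂_ρ g_{μν} + g_{μρ} ∂_ν ε^ρ + g_{ρν} ∂_μ ε^ρ`. -/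
def lieVar (g : EuclideanSpace ℝ (Fin 4) → Fin 4 → Fin 4 → ℝ)
    (ε : EuclideanSpace ℝ (Fin 4) → Fin 4 → ℝ)
    (x : EuclideanSpace ℝ (Fin 4)) (μ ν : Fin 4) : ℝ :=
  (∑ ρ, ε x ρ * pd ρ (fun y => g y μ ν) x)
    + (∑ ρ, g x μ ρ * pd ν (fun y => ε y ρ) x)
    + ∑ ρ, g x ρ ν * pd μ (fun y => ε y ρ) x

theorem abs_minkowski_le_one (μ ν : Fin 4) : |minkowski μ ν| ≤ 1 := by
  unfold minkowski
  split_ifs <;> norm_num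

/-- A sum of four terms bounded by `K` is bounded by `4 * K`. -/
theorem abs_sum_fin_four_le {f : Fin 4 → ℝ} {K : ℝ} (h : ∀ ρ, |f ρ| ≤ K) :
    |∑ ρ, f ρ| ≤ 4 * K := by
  refine (Finset.abs_sum_le_sum_abs f Finset.univ).trans ?_
  refine (Finset.sum_le_sum fun ρ _ => h ρ).trans ?_
  simp

/-- A product of quantities near `m` and `w` differs from `m * w` by `O(1/r)`. -/
theorem abs_mul_sub_mul_le {p q m w C K r : ℝ} (hC : 0 ≤ C) (hr : 1 ≤ r) (hm : |m| ≤ 1)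
    (hw : |w| + C ≤ K) (hp : |p - m| ≤ C / r) (hq : |q - w| ≤ C / r ^ 2) :
    |p * q - m * w| ≤ C * (K + 1) / r := by
  have hr0 : 0 < r := by linarith
  have hr2 : C / r ^ 2 ≤ C / r := by
    gcongr
    nlinarith
  have hrC : C / r ≤ C := div_le_self hC hr
  have hqK : |q| ≤ K := by
    have h := abs_add_le (q - w) w
    rw [sub_add_cancel] at h
    linarith
  calc |p * q - m * w| = |(p - m) * q + m * (q - w)| := by ring_nf
    _ ≤ |p - m| * |q| + |m| * |q - w| := by
      rw [← abs_mul, ← abs_mul]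
      exact abs_add_le _ _
    _ ≤ C / r * K + 1 * (C / r) := by
      gcongr
      exact hq.trans hr2
    _ = C * (K + 1) / r := by ring

/-- A vector field asymptotic to an affine one grows at most linearly. -/
theorem abs_le_mul_norm_of_asymptotically_affine {C W A e b : ℝ} (hC : 0 ≤ C)
    {w : Fin 4 → ℝ} (hw : ∑ ν, |w ν| ≤ W) (hb : |b| ≤ A)
    {x : EuclideanSpace ℝ (Fin 4)} (hx : 1 ≤ ‖x‖)
    (he : |e - (∑ ν, w ν * x ν) - b| ≤ C / ‖x‖) :
    |e| ≤ (W + A + C) * ‖x‖ := by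
  have hlin : |∑ ν, w ν * x ν| ≤ W * ‖x‖ := by
    calc |∑ ν, w ν * x ν| ≤ ∑ ν, |w ν * x ν| := Finset.abs_sum_le_sum_abs _ _
      _ ≤ ∑ ν, |w ν| * ‖x‖ := by
        refine Finset.sum_le_sum fun ν _ => ?_
        rw [abs_mul]
        gcongr
        exact PiLp.norm_apply_le x ν
      _ = (∑ ν, |w ν|) * ‖x‖ := by rw [Finset.sum_mul]
      _ ≤ W * ‖x‖ := by gcongr
  have hCx : C / ‖x‖ ≤ C := div_le_self hC hx
  have hsplit : |e| ≤ |e - (∑ ν, w ν * x ν) - b| + |∑ ν, w ν * x ν| + |b| := by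
    calc |e| = |(e - (∑ ν, w ν * x ν) - b) + (∑ ν, w ν * x ν) + b| := by ring_nf
      _ ≤ _ := abs_add_three _ _ _
  have hA : 0 ≤ A := (abs_nonneg b).trans hb
  nlinarith

/-- **Infinitesimal diffeomorphisms of asymptotically Poincaré type preserve
asymptotic flatness.**  If `g = η + O(1/r)` with `∂g = O(1/r²)`, and
`ε(x) = ωx + a + O(1/r)` with `∂ε = ω + O(1/r²)` where `ω` is an infinitesimal
Lorentz matrix (`ηω + ωᵀη = 0`), then `δ_D g = O(1/r)`. -/
theorem lie_variation_asymptotically_flat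
    (C : ℝ) (hC : 0 ≤ C)
    (g : EuclideanSpace ℝ (Fin 4) → Fin 4 → Fin 4 → ℝ)
    (hg : ContDiff ℝ 1 g)
    (hgsymm : ∀ x μ ν, g x μ ν = g x ν μ)
    (hg1 : ∀ x : EuclideanSpace ℝ (Fin 4), 1 ≤ ‖x‖ → ∀ μ ν,
      |g x μ ν - minkowski μ ν| ≤ C / ‖x‖)
    (hg2 : ∀ x : EuclideanSpace ℝ (Fin 4), 1 ≤ ‖x‖ → ∀ σ μ ν,
      |pd σ (fun y => g y μ ν) x| ≤ C / ‖x‖ ^ 2)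
    (ω : Fin 4 → Fin 4 → ℝ)
    (hω : ∀ μ ν, (∑ ρ, minkowski μ ρ * ω ρ ν) + (∑ ρ, ω ρ μ * minkowski ρ ν) = 0)
    (a : Fin 4 → ℝ)
    (ε : EuclideanSpace ℝ (Fin 4) → Fin 4 → ℝ)
    (hε : ContDiff ℝ 1 ε)
    (hε1 : ∀ x : EuclideanSpace ℝ (Fin 4), 1 ≤ ‖x‖ → ∀ μ,
      |ε x μ - (∑ ν, ω μ ν * x ν) - a μ| ≤ C / ‖x‖)
    (hε2 : ∀ x : EuclideanSpace ℝ (Fin 4), 1 ≤ ‖x‖ → ∀ μ ν,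
      |pd ν (fun y => ε y μ) x - ω μ ν| ≤ C / ‖x‖ ^ 2) :
    ∃ C' : ℝ, 0 ≤ C' ∧ ∀ x : EuclideanSpace ℝ (Fin 4), 1 ≤ ‖x‖ → ∀ μ ν,
      |lieVar g ε x μ ν| ≤ C' / ‖x‖ := by
  set W : ℝ := ∑ μ, ∑ ν, |ω μ ν|
  set A : ℝ := ∑ μ, |a μ|
  have hrow : ∀ μ, ∑ ν, |ω μ ν| ≤ W := fun μ =>
    Finset.single_le_sum (f := fun μ => ∑ ν, |ω μ ν|)
      (fun _ _ => Finset.sum_nonneg fun _ _ => abs_nonneg _) (Finset.mem_univ μ)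
  have hentry : ∀ μ ν, |ω μ ν| ≤ W := fun μ ν =>
    (Finset.single_le_sum (f := fun ν => |ω μ ν|) (fun _ _ => abs_nonneg _)
      (Finset.mem_univ ν)).trans (hrow μ)
  have ha : ∀ μ, |a μ| ≤ A := fun μ =>
    Finset.single_le_sum (f := fun μ => |a μ|) (fun _ _ => abs_nonneg _) (Finset.mem_univ μ)
  have hW0 : 0 ≤ W := (abs_nonneg _).trans (hentry 0 0)
  have hA0 : 0 ≤ A := (abs_nonneg _).trans (ha 0)
  set K : ℝ := W + A + C
  have hωK : ∀ μ ν, |ω μ ν| + C ≤ K := fun μ ν => by linarith [hentry μ ν]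
  refine ⟨4 * (K * C) + 8 * (C * (K + 1)), by positivity, fun x hx μ ν => ?_⟩
  have hx0 : 0 < ‖x‖ := by linarith
  have htransport : |∑ ρ, ε x ρ * pd ρ (fun y => g y μ ν) x| ≤ 4 * (K * C / ‖x‖) := by
    refine abs_sum_fin_four_le fun ρ => ?_
    have hε_le := abs_le_mul_norm_of_asymptotically_affine hC (hrow ρ) (ha ρ) hx (hε1 x hx ρ)
    rw [abs_mul]
    calc _ ≤ K * ‖x‖ * (C / ‖x‖ ^ 2) :=
          mul_le_mul hε_le (hg2 x hx ρ μ ν) (abs_nonneg _) (by positivity)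
      _ = K * C / ‖x‖ := by field_simp
  have hright : |∑ ρ, (g x μ ρ * pd ν (fun y => ε y ρ) x - minkowski μ ρ * ω ρ ν)|
      ≤ 4 * (C * (K + 1) / ‖x‖) :=
    abs_sum_fin_four_le fun ρ => abs_mul_sub_mul_le hC hx (abs_minkowski_le_one μ ρ) (hωK ρ ν)
      (hg1 x hx μ ρ) (hε2 x hx ρ ν)
  have hleft : |∑ ρ, (g x ρ ν * pd μ (fun y => ε y ρ) x - minkowski ρ ν * ω ρ μ)|
      ≤ 4 * (C * (K + 1) / ‖x‖) :=
    abs_sum_fin_four_le fun ρ => abs_mul_sub_mul_le hC hx (abs_minkowski_le_one ρ ν) (hωK ρ μ)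
      (hg1 x hx ρ ν) (hε2 x hx ρ μ)
  have hsplit : lieVar g ε x μ ν = (∑ ρ, ε x ρ * pd ρ (fun y => g y μ ν) x)
      + (∑ ρ, (g x μ ρ * pd ν (fun y => ε y ρ) x - minkowski μ ρ * ω ρ ν))
      + ∑ ρ, (g x ρ ν * pd μ (fun y => ε y ρ) x - minkowski ρ ν * ω ρ μ) := by
    have hkilling := hω μ ν
    simp only [mul_comm (ω _ μ)] at hkilling
    simp only [lieVar, Finset.sum_sub_distrib]
    linarith
  rw [hsplit]
  calc _ ≤ 4 * (K * C / ‖x‖) + 4 * (C * (K + 1) / ‖x‖) + 4 * (C * (K + 1) / ‖x‖) :=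
        (abs_add_three _ _ _).trans (by gcongr)
    _ = (4 * (K * C) + 8 * (C * (K + 1))) / ‖x‖ := by ring

end
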